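/- arXiv:1109.0964 — 2 statements merged into one kernel-verified Lean document; each statement's English description precedes it below -/
import Mathlib

section
/- Let a, b, with a ≤ b, and let ψ : Fin a × Fin b → ℂ be any vector (viewed as a pure state of a bipartite system ℂ^a ⊗ ℂ^b). Then there exists a unitary matrix U ∈ Matrix.unitaryGroup (Fin b) ℂ acting on the second factor such that the transformed vector ψ', defined by ψ' (i, j) = ∑_{k : Fin b} U j k * ψ (i, k), satisfies ψ' (i, j) = 0 whenever the index j (as a natural number) satisfies a ≤ j. In other words, a unitary on the second system can compress the support of any bipartite vector into the first a basis vectors of the second factor. -/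
/-- A unitary on the second factor of a bipartite system can compress
the support of any bipartite vector into the first `a` basis vectors of the
second factor. -/
theorem bipartite_support_compression (a b : ℕ) (hab : a ≤ b)
    (ψ : Fin a × Fin b → ℂ) :
    ∃ U ∈ Matrix.unitaryGroup (Fin b) ℂ,
      ∀ i : Fin a, ∀ j : Fin b, a ≤ (j : ℕ) →
        (∑ k : Fin b, U j k * ψ (i, k)) = 0 := by
  let f : Fin b → EuclideanSpace ℂ (Fin b) := fun m =>
    if hm : (m : ℕ) < a then WithLp.toLp 2 fun k => ψ (⟨m, hm⟩, k) else 0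
  let e := InnerProductSpace.gramSchmidtOrthonormalBasis (𝕜 := ℂ) (by simp) f
  refine ⟨e.toBasis.toMatrix (EuclideanSpace.basisFun (Fin b) ℂ),
    e.toMatrix_orthonormalBasis_mem_unitary _, fun i j hj => ?_⟩
  have hij : Fin.castLE hab i < j := i.isLt.trans_le hj
  have h : inner ℂ (e j) (f (Fin.castLE hab i)) = 0 :=
    InnerProductSpace.gramSchmidtOrthonormalBasis_inv_triangular _ f hij
  have hf : f (Fin.castLE hab i) = WithLp.toLp 2 fun k => ψ (i, k) := by simp [f]
  rw [hf, PiLp.inner_apply] at h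
  simpa [Module.Basis.toMatrix_apply, OrthonormalBasis.repr_apply_apply,
    EuclideanSpace.inner_single_right, mul_comm] using h
end

section
/- Fix natural numbers m ≥ 1, p, v. Consider a quantum interactive protocol with prover private register P of dimension 2^p, a single message qubit M of dimension 2, and verifier private register V of dimension 2^v, so that the total state is a vector indexed by Fin (2^p) × Fin 2 × Fin (2^v). Let W_1, …, W_m be unitaries on ℂ^2 ⊗ ℂ^{2^v} (the verifier's operations, acting on M and V), and let U_1, …, U_m be unitaries on ℂ^{2^p} ⊗ ℂ^2 (the prover's operations, acting on P and M). Define ψ_0 to be the standard basis vector with all registers in state |0…0⟩, and recursively ψ_i = (U_i ⊗ I_V) (I_P ⊗ W_i) ψ_{i−1} (with the canonical associativity reindexing between (ℂ^{2^p} ⊗ ℂ^2) ⊗ ℂ^{2^v} and ℂ^{2^p} ⊗ (ℂ^2 ⊗ ℂ^{2^v})). Then there exist unitaries U'_1, …, U'_m on ℂ^{2^{2m}} ⊗ ℂ^2 such that, defining ψ'_i analogously with prover register of dimension 2^{2m} (i.e. ψ'_0 the all-zero basis vector and ψ'_i = (U'_i ⊗ I_V)(I_{P'} ⊗ W_i)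 ψ'_{i−1}), the following hold for every i with 0 ≤ i ≤ m: (a) the partial trace over the prover factor of the rank-one projection ψ'_i (ψ'_i)ᴴ equals the partial trace over the prover factor of ψ_i (ψ_i)ᴴ (as matrices indexed by Fin 2 × Fin (2^v)); and (b) ψ'_i (j, q, w) = 0 whenever the prover index j (as a natural number) satisfies 2^{2i} ≤ j, i.e. at most 2i qubits of the prover's register differ from |0⟩ after round i. -/
open scoped ComplexConjugate

/-- Apply the verifier's unitary `W` (acting on message and verifier registers)
to a tripartite state vector. -/
noncomputable def applyVerifier {P Q V : Type*} [Fintype Q] [Fintype V]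
    (W : Matrix (Q × V) (Q × V) ℂ) (ψ : P × Q × V → ℂ) : P × Q × V → ℂ :=
  fun x => ∑ y : Q × V, W (x.2.1, x.2.2) y * ψ (x.1, y.1, y.2)

/-- Apply the prover's unitary `U` (acting on prover and message registers)
to a tripartite state vector. -/
noncomputable def applyProver {P Q V : Type*} [Fintype P] [Fintype Q]
    (U : Matrix (P × Q) (P × Q) ℂ) (ψ : P × Q × V → ℂ) : P × Q × V → ℂ :=
  fun x => ∑ y : P × Q, U (x.1, x.2.1) y * ψ (y.1, y.2, x.2.2)

/-- The state after `i` rounds of interaction, starting from the all-zero basis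
state, where in each round the verifier first applies `W j` and the prover then
applies `U j`. -/
noncomputable def roundsState {p v : ℕ}
    (W : ℕ → Matrix (Fin 2 × Fin (2 ^ v)) (Fin 2 × Fin (2 ^ v)) ℂ)
    (U : ℕ → Matrix (Fin (2 ^ p) × Fin 2) (Fin (2 ^ p) × Fin 2) ℂ) :
    ℕ → (Fin (2 ^ p) × Fin 2 × Fin (2 ^ v) → ℂ)
  | 0 => fun x => if x.1 = 0 ∧ x.2.1 = 0 ∧ x.2.2 = 0 then 1 else 0
  | (i + 1) => applyProver (U i) (applyVerifier (W i) (roundsState W U i))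

open Matrix

/-- Two linear maps with the same pointwise norms differ by a linear isometry of the codomain. -/
theorem exists_linearIsometry_comp_eq {E F : Type*} [AddCommGroup E] [Module ℂ E]
    [NormedAddCommGroup F] [InnerProductSpace ℂ F] [FiniteDimensional ℂ F]
    (f g : E →ₗ[ℂ] F) (h : ∀ x, ‖f x‖ = ‖g x‖) :
    ∃ u : F →ₗᵢ[ℂ] F, ∀ x, u (f x) = g x := by
  obtain ⟨s, hs⟩ := f.rangeRestrict.exists_rightInverse_of_surjective f.range_rangeRestrict
  have hfs : ∀ y, f (s y) = y := fun y => congrArg Subtype.val (LinearMap.congr_fun hs y)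
  let L : LinearMap.range f →ₗᵢ[ℂ] F :=
    { toLinearMap := g ∘ₗ s
      norm_map' := fun y => by
        rw [LinearMap.comp_apply, ← h, hfs, Submodule.coe_norm] }
  refine ⟨L.extend, fun x => ?_⟩
  have hx : L.extend (f x) = g (s (f.rangeRestrict x)) := L.extend_apply (f.rangeRestrict x)
  rw [hx, ← sub_eq_zero, ← map_sub, ← norm_eq_zero, ← h, map_sub, hfs]
  simp

/-- Matrices with the same Gram matrix differ by a unitary on the left. -/
theorem Matrix.exists_unitary_mul_eq {n k : Type*} [Fintype n] [DecidableEq n] [Fintype k]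
    [DecidableEq k] (A B : Matrix n k ℂ) (h : Aᴴ * A = Bᴴ * B) :
    ∃ U ∈ Matrix.unitaryGroup n ℂ, U * A = B := by
  have hnorm : ∀ x, ‖A.toEuclideanLin x‖ = ‖B.toEuclideanLin x‖ := fun x => by
    have key : ∀ C : Matrix n k ℂ, ((‖C.toEuclideanLin x‖ ^ 2 : ℝ) : ℂ)
        = star x.ofLp ⬝ᵥ ((Cᴴ * C) *ᵥ x.ofLp) := fun C => by
      push_cast
      rw [← Complex.coe_algebraMap, ← inner_self_eq_norm_sq_to_K (𝕜 := ℂ),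
        EuclideanSpace.inner_eq_star_dotProduct, dotProduct_comm, ← mulVec_mulVec,
        dotProduct_mulVec _ Cᴴ, ← star_mulVec]
      rfl
    have := (key A).trans ((congrArg (fun M => star x.ofLp ⬝ᵥ (M *ᵥ x.ofLp)) h).trans (key B).symm)
    exact (sq_eq_sq₀ (norm_nonneg _) (norm_nonneg _)).1 (Complex.ofReal_injective this)
  obtain ⟨u, hu⟩ := exists_linearIsometry_comp_eq A.toEuclideanLin B.toEuclideanLin hnorm
  refine ⟨(Matrix.toEuclideanCLM (𝕜 := ℂ)).symm u.toContinuousLinearMap, ?_, ?_⟩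
  · rw [Matrix.mem_unitaryGroup_iff']
    apply EquivLike.injective (Matrix.toEuclideanCLM (n := n) (𝕜 := ℂ))
    rw [map_mul, map_star, StarAlgEquiv.apply_symm_apply, map_one]
    exact (ContinuousLinearMap.norm_map_iff_adjoint_comp_self _).1 u.norm_map
  · apply Matrix.toEuclideanLin.injective
    ext1 x
    rw [← hu x, Matrix.toLpLin_mul 2 2 2, LinearMap.comp_apply,
      ← Matrix.coe_toEuclideanCLM_eq_toEuclideanLin, StarAlgEquiv.apply_symm_apply]
    rfl

open scoped ComplexOrder MatrixOrder Matrix.Norms.L2Operator in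
/-- A matrix factoring through `ι` has the same Gram matrix as one with rows indexed by `ι`. -/
theorem Matrix.exists_gram_eq_of_factor {P ι N : Type*} [Fintype P] [Fintype ι]
    (B : Matrix P ι ℂ) (C : Matrix ι N ℂ) :
    ∃ A : Matrix ι N ℂ, Aᴴ * A = (B * C)ᴴ * (B * C) := by
  classical
  obtain ⟨S, hS⟩ : ∃ S : Matrix ι ι ℂ, Bᴴ * B = star S * S := CStarAlgebra.nonneg_iff_eq_star_mul_self.1
    (Matrix.posSemidef_conjTranspose_mul_self B).nonneg
  refine ⟨S * C, ?_⟩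
  rw [conjTranspose_mul, conjTranspose_mul, Matrix.mul_assoc, ← Matrix.mul_assoc Sᴴ, ← star_eq_conjTranspose S, ← hS]
  simp only [Matrix.mul_assoc]

/-- The state vector as a matrix from the prover register to the other two. -/
def proverMatrix {P Q V : Type*} (ψ : P × Q × V → ℂ) : Matrix P (Q × V) ℂ :=
  Matrix.of fun p y => ψ (p, y)

/-- The state vector as a matrix from prover and message registers to the verifier register. -/
def verifierMatrix {P Q V : Type*} (ψ : P × Q × V → ℂ) : Matrix (P × Q) V ℂ :=
  Matrix.of fun x w => ψ (x.1, x.2, w)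

theorem proverMatrix_applyVerifier {P Q V : Type*} [Fintype Q] [Fintype V]
    (W : Matrix (Q × V) (Q × V) ℂ) (ψ : P × Q × V → ℂ) :
    proverMatrix (applyVerifier W ψ) = proverMatrix ψ * Wᵀ := by
  ext p y
  simp [proverMatrix, applyVerifier, Matrix.mul_apply, mul_comm]

theorem verifierMatrix_applyProver {P Q V : Type*} [Fintype P] [Fintype Q]
    (U : Matrix (P × Q) (P × Q) ℂ) (ψ : P × Q × V → ℂ) :
    verifierMatrix (applyProver U ψ) = U * verifierMatrix ψ := by
  ext p y
  simp [verifierMatrix, applyProver, Matrix.mul_apply]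

theorem verifierMatrix_injective {P Q V : Type*} :
    Function.Injective (verifierMatrix : (P × Q × V → ℂ) → Matrix (P × Q) V ℂ) := by
  intro ψ φ h
  ext ⟨p, q, w⟩
  exact congrFun (congrFun h (p, q)) w

theorem verifierMatrix_gram_apply {P Q V : Type*} [Fintype P] [Fintype Q]
    (ψ : P × Q × V → ℂ) (w w' : V) :
    ((verifierMatrix ψ)ᴴ * verifierMatrix ψ) w w'
      = ∑ q, ((proverMatrix ψ)ᴴ * proverMatrix ψ) (q, w) (q, w') := by
  simp only [verifierMatrix, proverMatrix, Matrix.mul_apply, conjTranspose_apply, of_apply,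
    Fintype.sum_prod_type_right]

theorem verifierMatrix_gram_congr {P P' Q V : Type*} [Fintype P] [Fintype P'] [Fintype Q]
    {ψ : P × Q × V → ℂ} {φ : P' × Q × V → ℂ}
    (h : (proverMatrix ψ)ᴴ * proverMatrix ψ = (proverMatrix φ)ᴴ * proverMatrix φ) :
    (verifierMatrix ψ)ᴴ * verifierMatrix ψ = (verifierMatrix φ)ᴴ * verifierMatrix φ := by
  ext w w'
  rw [verifierMatrix_gram_apply, verifierMatrix_gram_apply, h]

theorem proverMatrix_gram_applyVerifier_congr {P P' Q V : Type*} [Fintype P] [Fintype P']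
    [Fintype Q] [Fintype V] (W : Matrix (Q × V) (Q × V) ℂ)
    {ψ : P × Q × V → ℂ} {φ : P' × Q × V → ℂ}
    (h : (proverMatrix ψ)ᴴ * proverMatrix ψ = (proverMatrix φ)ᴴ * proverMatrix φ) :
    (proverMatrix (applyVerifier W ψ))ᴴ * proverMatrix (applyVerifier W ψ)
      = (proverMatrix (applyVerifier W φ))ᴴ * proverMatrix (applyVerifier W φ) := by
  simp only [proverMatrix_applyVerifier, conjTranspose_mul, Matrix.mul_assoc]
  rw [← Matrix.mul_assoc _ _ Wᵀ, h, Matrix.mul_assoc]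

theorem verifierMatrix_gram_applyProver {P Q V : Type*} [Fintype P] [Fintype Q]
    [DecidableEq P] [DecidableEq Q] {U : Matrix (P × Q) (P × Q) ℂ}
    (hU : U ∈ Matrix.unitaryGroup (P × Q) ℂ) (ψ : P × Q × V → ℂ) :
    (verifierMatrix (applyProver U ψ))ᴴ * verifierMatrix (applyProver U ψ)
      = (verifierMatrix ψ)ᴴ * verifierMatrix ψ := by
  have hUU : Uᴴ * U = 1 := Matrix.mem_unitaryGroup_iff'.1 hU
  rw [verifierMatrix_applyProver, conjTranspose_mul, Matrix.mul_assoc, ← Matrix.mul_assoc Uᴴ,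
    hUU, Matrix.one_mul]

theorem verifierMatrix_factor {P Q V ι : Type*} [Fintype Q] [DecidableEq Q] [Fintype ι]
    {ψ : P × Q × V → ℂ} {B : Matrix P ι ℂ} {C : Matrix ι (Q × V) ℂ}
    (h : proverMatrix ψ = B * C) :
    ∃ (B' : Matrix (P × Q) (ι × Q) ℂ) (C' : Matrix (ι × Q) V ℂ), verifierMatrix ψ = B' * C' := by
  refine ⟨of fun x k => if x.2 = k.2 then B x.1 k.1 else 0, of fun k w => C k.1 (k.2, w), ?_⟩
  ext ⟨p, q⟩ w
  have := congrFun (congrFun h p) (q, w)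
  simpa [verifierMatrix, proverMatrix, Matrix.mul_apply, Fintype.sum_prod_type] using this

theorem proverMatrix_factor {P Q V ι : Type*} [Fintype Q] [DecidableEq Q] [Fintype ι]
    {ψ : P × Q × V → ℂ} {B : Matrix (P × Q) ι ℂ} {C : Matrix ι V ℂ}
    (h : verifierMatrix ψ = B * C) :
    ∃ (B' : Matrix P (ι × Q) ℂ) (C' : Matrix (ι × Q) (Q × V) ℂ), proverMatrix ψ = B' * C' := by
  refine ⟨of fun p k => B (p, k.2) k.1, of fun k y => if y.1 = k.2 then C k.1 y.2 else 0, ?_⟩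
  ext p ⟨q, w⟩
  have := congrFun (congrFun h (p, q)) w
  simpa [verifierMatrix, proverMatrix, Matrix.mul_apply, Fintype.sum_prod_type] using this

/-- The Schmidt rank between prover and the rest grows by a factor at most four per round. -/
theorem exists_factor_roundsState {p v : ℕ}
    (W : ℕ → Matrix (Fin 2 × Fin (2 ^ v)) (Fin 2 × Fin (2 ^ v)) ℂ)
    (U : ℕ → Matrix (Fin (2 ^ p) × Fin 2) (Fin (2 ^ p) × Fin 2) ℂ) (i : ℕ) :
    ∃ (B : Matrix (Fin (2 ^ p)) (Fin (2 ^ (2 * i))) ℂ)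
      (C : Matrix (Fin (2 ^ (2 * i))) (Fin 2 × Fin (2 ^ v)) ℂ),
      proverMatrix (roundsState W U i) = B * C := by
  induction i with
  | zero =>
    refine ⟨of fun j _ => if j = 0 then 1 else 0,
      of fun _ y => if y.1 = 0 ∧ y.2 = 0 then 1 else 0, ?_⟩
    ext j y
    simp [proverMatrix, roundsState, Matrix.mul_apply, ← ite_and, and_comm]
  | succ i ih =>
    obtain ⟨B, C, h⟩ := ih
    have h₁ : proverMatrix (applyVerifier (W i) (roundsState W U i)) = B * (C * (W i)ᵀ) := by
      rw [proverMatrix_applyVerifier, h, Matrix.mul_assoc]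
    obtain ⟨B₂, C₂, h₂⟩ := verifierMatrix_factor h₁
    have h₃ : verifierMatrix (roundsState W U (i + 1)) = (U i * B₂) * C₂ := by
      rw [roundsState, verifierMatrix_applyProver, h₂, Matrix.mul_assoc]
    obtain ⟨B₄, C₄, h₄⟩ := proverMatrix_factor h₃
    let e : Fin (2 ^ (2 * (i + 1))) ≃ (Fin (2 ^ (2 * i)) × Fin 2) × Fin 2 :=
      Fintype.equivOfCardEq (by simp; ring)
    refine ⟨B₄.submatrix id e, C₄.submatrix e id, ?_⟩
    rw [h₄, Matrix.submatrix_mul_equiv, Matrix.submatrix_id_id]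

/-- Padding a matrix with zero rows preserves its Gram matrix. -/
theorem Matrix.exists_gram_eq_of_le {d K : ℕ} (hd : d ≤ K) {N : Type*} (A : Matrix (Fin d) N ℂ) :
    ∃ A' : Matrix (Fin K) N ℂ, A'ᴴ * A' = Aᴴ * A ∧ ∀ j : Fin K, d ≤ (j : ℕ) → A' j = 0 := by
  obtain ⟨k, rfl⟩ := Nat.exists_eq_add_of_le hd
  refine ⟨of (Fin.append (fun j => A j) fun _ => 0), ?_, fun j hj => ?_⟩
  · ext x y
    simp [Matrix.mul_apply, Fin.sum_univ_add]
  · obtain ⟨l, rfl⟩ : ∃ l, j = Fin.natAdd d l := ⟨⟨j - d, by omega⟩, by ext; simp; omega⟩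
    exact Fin.append_right (fun j => A j) (fun _ => 0) l

theorem exists_compressed_roundsState {p v : ℕ} (m : ℕ)
    (W : ℕ → Matrix (Fin 2 × Fin (2 ^ v)) (Fin 2 × Fin (2 ^ v)) ℂ)
    (U : ℕ → Matrix (Fin (2 ^ p) × Fin 2) (Fin (2 ^ p) × Fin 2) ℂ) (i : ℕ) (hi : i ≤ m) :
    ∃ φ : Fin (2 ^ (2 * m)) × Fin 2 × Fin (2 ^ v) → ℂ,
      (i = 0 → φ = fun x => if x.1 = 0 ∧ x.2.1 = 0 ∧ x.2.2 = 0 then 1 else 0) ∧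
      (proverMatrix φ)ᴴ * proverMatrix φ
        = (proverMatrix (roundsState W U i))ᴴ * proverMatrix (roundsState W U i) ∧
      ∀ j : Fin (2 ^ (2 * m)), 2 ^ (2 * i) ≤ (j : ℕ) → ∀ y, φ (j, y) = 0 := by
  rcases Nat.eq_zero_or_pos i with rfl | hpos
  · refine ⟨_, fun _ => rfl, ?_, fun j hj y => ?_⟩
    · ext x y
      simp [proverMatrix, roundsState, Matrix.mul_apply, ite_and]
    · have : j ≠ 0 := by rintro rfl; simp at hj
      simp [this]
  · obtain ⟨B, C, h⟩ := exists_factor_roundsState W U i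
    obtain ⟨A, hA⟩ := Matrix.exists_gram_eq_of_factor B C
    obtain ⟨A', hA', h0⟩ := A.exists_gram_eq_of_le
      (Nat.pow_le_pow_right two_pos (Nat.mul_le_mul_left 2 hi))
    refine ⟨fun x => A' x.1 x.2, fun h => absurd h hpos.ne', ?_, fun j hj y => ?_⟩
    · rw [h, ← hA, ← hA']
      rfl
    · exact congrFun (h0 j hj) y

/-- Compression of the prover's private space.  For any verifier
strategy `W` and prover strategy `U` (with prover register on `p` qubits), there
is an equivalent prover strategy `U'` using only `2m` qubits of private memory
which produces, after every round `i ≤ m`, the same reduced state on the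
message-plus-verifier registers, and whose private register after round `i` is
supported on its first `2^(2i)` basis vectors (i.e. at most `2i` qubits differ
from `|0⟩`). -/
theorem prover_space_compression (m p v : ℕ) (hm : 1 ≤ m)
    (W : ℕ → Matrix (Fin 2 × Fin (2 ^ v)) (Fin 2 × Fin (2 ^ v)) ℂ)
    (hW : ∀ i, W i ∈ Matrix.unitaryGroup (Fin 2 × Fin (2 ^ v)) ℂ)
    (U : ℕ → Matrix (Fin (2 ^ p) × Fin 2) (Fin (2 ^ p) × Fin 2) ℂ)
    (hU : ∀ i, U i ∈ Matrix.unitaryGroup (Fin (2 ^ p) × Fin 2) ℂ) :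
    ∃ U' : ℕ → Matrix (Fin (2 ^ (2 * m)) × Fin 2) (Fin (2 ^ (2 * m)) × Fin 2) ℂ,
      (∀ i, U' i ∈ Matrix.unitaryGroup (Fin (2 ^ (2 * m)) × Fin 2) ℂ) ∧
      (∀ i ≤ m, ∀ x y : Fin 2 × Fin (2 ^ v),
        -- (a) the reduced state on message and verifier registers is unchanged
        (∑ j : Fin (2 ^ (2 * m)),
            roundsState W U' i (j, x.1, x.2) * conj (roundsState W U' i (j, y.1, y.2)))
          = ∑ j : Fin (2 ^ p),
              roundsState W U i (j, x.1, x.2) * conj (roundsState W U i (j, y.1, y.2))) ∧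
      (∀ i ≤ m, ∀ j : Fin (2 ^ (2 * m)), ∀ q : Fin 2, ∀ w : Fin (2 ^ v),
        -- (b) at most 2i qubits of the prover's register differ from |0⟩
        2 ^ (2 * i) ≤ (j : ℕ) → roundsState W U' i (j, q, w) = 0) := by
  choose! φ hφ₀ hφ hφs using exists_compressed_roundsState m W U
  have hstep : ∀ i, ∃ U' ∈ Matrix.unitaryGroup (Fin (2 ^ (2 * m)) × Fin 2) ℂ,
      i < m → applyProver U' (applyVerifier (W i) (φ i)) = φ (i + 1) := fun i => by
    by_cases him : i < m
    · obtain ⟨U', hU', h⟩ := Matrix.exists_unitary_mul_eq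
        (verifierMatrix (applyVerifier (W i) (φ i))) (verifierMatrix (φ (i + 1))) <| by
          rw [verifierMatrix_gram_congr (hφ (i + 1) him), roundsState,
            verifierMatrix_gram_applyProver (hU i)]
          exact verifierMatrix_gram_congr
            (proverMatrix_gram_applyVerifier_congr (W i) (hφ i him.le))
      exact ⟨U', hU', fun _ => verifierMatrix_injective <| by rw [verifierMatrix_applyProver, h]⟩
    · exact ⟨1, one_mem _, fun h => absurd h him⟩
  choose U' hU' hstep using hstep
  have hrounds : ∀ i ≤ m, roundsState W U' i = φ i := fun i => by
    induction i with
    | zero => exact fun h => (hφ₀ 0 h rfl).symm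
    | succ i ih => exact fun h => by rw [roundsState, ih (by omega), hstep i h]
  refine ⟨U', hU', fun i hi x y => ?_, fun i hi j q w hj => ?_⟩
  · have := congrFun (congrFun (hφ i hi) y) x
    rw [hrounds i hi]
    simpa [proverMatrix, Matrix.mul_apply, mul_comm] using this
  · rw [hrounds i hi]
    exact hφs i hi j hj (q, w)
end
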